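/- arXiv:2306.04208 — 5 statements merged into one kernel-verified Lean document; each statement's English description precedes it below -/
import Mathlib

section
/- Let f : ℝⁿ → ℝ be continuously differentiable with L_∇f-Lipschitz gradient, let Q : ℝⁿ × ℝᵐ → ℝ ∪ {+∞} be proper and lower semicontinuous, and let φ₁ : ℝⁿ → ℝ be differentiable and θ₁-strongly convex with θ₁ > L_∇f. Fix x̂ ∈ ℝⁿ and ŷ ∈ ℝᵐ with Q(x̂, ŷ) < +∞. If x⁺ is a minimizer over ℝⁿ of x ↦ Q(x, ŷ) + ⟨∇f(x̂), x⟩ + D_{φ₁}(x, x̂), then f(x⁺) + Q(x⁺, ŷ) ≤ f(x̂) + Q(x̂, ŷ) − ((θ₁ − L_∇f)/2)‖x⁺ − x̂‖². -/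
open scoped RealInnerProductSpace

/-- The Bregman distance `D_φ(x, y) = φ(x) − φ(y) − ⟨∇φ(y), x − y⟩`. -/
noncomputable def breg {d : ℕ} (φ : EuclideanSpace ℝ (Fin d) → ℝ)
    (x y : EuclideanSpace ℝ (Fin d)) : ℝ :=
  φ x - φ y - ⟪gradient φ y, x - y⟫

section

variable {E : Type*} [NormedAddCommGroup E] [InnerProductSpace ℝ E] [CompleteSpace E]

/-- The derivative of a function along the line through `y` with direction `v`. -/
theorem hasDerivAt_comp_line {f : E → ℝ} (hf : Differentiable ℝ f) (y v : E) (t : ℝ) :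
    HasDerivAt (fun s : ℝ => f (y + s • v)) ⟪gradient f (y + t • v), v⟫ t := by
  have hline : HasDerivAt (fun s : ℝ => y + s • v) v t := by
    simpa using ((hasDerivAt_id t).smul_const v).const_add y
  exact (hf (y + t • v)).hasGradientAt.hasFDerivAt.comp_hasDerivAt t hline

/-- The gradient inequality for differentiable convex functions. -/
theorem ConvexOn.inner_gradient_le {φ : E → ℝ} (hφ : ConvexOn ℝ Set.univ φ)
    (hd : Differentiable ℝ φ) (x y : E) : ⟪gradient φ y, x - y⟫ ≤ φ x - φ y := by
  have hconv : ConvexOn ℝ Set.univ (fun s : ℝ => φ (y + s • (x - y))) := by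
    refine ⟨convex_univ, fun a _ b _ p q hp hq hpq => ?_⟩
    have h := hφ.2 (Set.mem_univ (y + a • (x - y))) (Set.mem_univ (y + b • (x - y))) hp hq hpq
    have e : y + (p • a + q • b) • (x - y)
        = p • (y + a • (x - y)) + q • (y + b • (x - y)) := by
      obtain rfl : q = 1 - p := by linarith
      simp only [smul_eq_mul]
      module
    simpa only [e] using h
  have h := hconv.le_slope_of_hasDerivAt (Set.mem_univ 0) (Set.mem_univ 1) one_pos
    (hasDerivAt_comp_line hd y (x - y) 0)
  simpa [slope_def_field] using h

/-- The gradient inequality for differentiable strongly convex functions. -/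
theorem inner_gradient_add_sq_le_of_convexOn_sub {φ : E → ℝ} {θ : ℝ}
    (hφ : ConvexOn ℝ Set.univ (fun u => φ u - θ / 2 * ‖u‖ ^ 2))
    (hd : Differentiable ℝ φ) (x y : E) :
    ⟪gradient φ y, x - y⟫ + θ / 2 * ‖x - y‖ ^ 2 ≤ φ x - φ y := by
  have hsq : HasGradientAt (fun u : E => φ u - θ / 2 * ‖u‖ ^ 2) (gradient φ y - θ • y) y := by
    rw [hasGradientAt_iff_hasFDerivAt]
    refine ((hd y).hasGradientAt.hasFDerivAt.sub
      ((hasStrictFDerivAt_norm_sq y).hasFDerivAt.const_mul (θ / 2))).congr_fderiv ?_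
    rw [map_sub]
    congr 1
    ext v
    change θ / 2 * (2 • ⟪y, v⟫) = ⟪θ • y, v⟫
    rw [real_inner_smul_left, nsmul_eq_mul]
    push_cast
    ring
  have h := hφ.inner_gradient_le (hd.sub ((differentiable_id.norm_sq ℝ).const_mul _)) x y
  rw [hsq.gradient] at h
  have e : ‖x - y‖ ^ 2 = ‖x‖ ^ 2 - ‖y‖ ^ 2 - 2 * ⟪y, x - y⟫ := by
    rw [norm_sub_sq_real, inner_sub_right, real_inner_self_eq_norm_sq, real_inner_comm]
    ring
  rw [inner_sub_left, real_inner_smul_left] at h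
  rw [e]
  linarith

/-- The descent lemma for functions with Lipschitz gradient. -/
theorem le_add_inner_gradient_add_sq {f : E → ℝ} {L : ℝ} (hf : Differentiable ℝ f)
    (hL : ∀ a b, ‖gradient f a - gradient f b‖ ≤ L * ‖a - b‖) (x y : E) :
    f x ≤ f y + ⟪gradient f y, x - y⟫ + L / 2 * ‖x - y‖ ^ 2 := by
  set v := x - y with hv
  have hder (t : ℝ) : HasDerivAt
      (fun s : ℝ => f (y + s • v) - s * ⟪gradient f y, v⟫ - s ^ 2 * (L / 2 * ‖v‖ ^ 2))
      (⟪gradient f (y + t • v), v⟫ - ⟪gradient f y, v⟫ - t * (L * ‖v‖ ^ 2)) t := by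
    refine (((hasDerivAt_comp_line hf y v t).sub
      ((hasDerivAt_id t).mul_const ⟪gradient f y, v⟫)).sub
      ((hasDerivAt_pow 2 t).mul_const (L / 2 * ‖v‖ ^ 2))).congr_deriv ?_
    push_cast
    ring
  have hanti := antitoneOn_of_deriv_nonpos (convex_Icc (0 : ℝ) 1)
    (fun t _ => (hder t).continuousAt.continuousWithinAt)
    (fun t _ => (hder t).differentiableAt.differentiableWithinAt) (fun t ht => by
      rw [interior_Icc] at ht
      rw [(hder t).deriv, ← inner_sub_left, sub_nonpos]
      calc ⟪gradient f (y + t • v) - gradient f y, v⟫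
          ≤ ‖gradient f (y + t • v) - gradient f y‖ * ‖v‖ := real_inner_le_norm _ _
        _ ≤ L * ‖y + t • v - y‖ * ‖v‖ := by gcongr; exact hL _ _
        _ = t * (L * ‖v‖ ^ 2) := by
          rw [add_sub_cancel_left, norm_smul, Real.norm_of_nonneg ht.1.le]
          ring)
  have h := hanti (Set.left_mem_Icc.2 zero_le_one) (Set.right_mem_Icc.2 zero_le_one) zero_le_one
  norm_num [-inner_gradient_left] at h
  rw [hv, add_sub_cancel, ← hv] at h
  linarith

end

/-- sufficient decrease for the `x`-subproblem of the Bregman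
alternating structure-adapted proximal gradient step. -/
theorem x_subproblem_decrease {n m : ℕ}
    (f : EuclideanSpace ℝ (Fin n) → ℝ)
    (Q : EuclideanSpace ℝ (Fin n) → EuclideanSpace ℝ (Fin m) → EReal)
    (φ₁ : EuclideanSpace ℝ (Fin n) → ℝ) (Lf θ₁ : ℝ)
    (hf : ContDiff ℝ 1 f)
    (hfLip : ∀ a b, ‖gradient f a - gradient f b‖ ≤ Lf * ‖a - b‖)
    (hQproper : (∀ a b, Q a b ≠ ⊥) ∧ ∃ a b, Q a b ≠ ⊤)
    (hQlsc : LowerSemicontinuous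
      (fun p : EuclideanSpace ℝ (Fin n) × EuclideanSpace ℝ (Fin m) => Q p.1 p.2))
    (hφ₁diff : Differentiable ℝ φ₁) (hθ₁pos : 0 < θ₁)
    (hφ₁sc : ConvexOn ℝ Set.univ (fun u => φ₁ u - θ₁ / 2 * ‖u‖ ^ 2))
    (hθ₁ : Lf < θ₁)
    (xh : EuclideanSpace ℝ (Fin n)) (yh : EuclideanSpace ℝ (Fin m))
    (hdom : Q xh yh < ⊤)
    (xp : EuclideanSpace ℝ (Fin n))
    (hmin : ∀ x', Q xp yh + ((⟪gradient f xh, xp⟫ + breg φ₁ xp xh : ℝ) : EReal)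
        ≤ Q x' yh + ((⟪gradient f xh, x'⟫ + breg φ₁ x' xh : ℝ) : EReal)) :
    (f xp : EReal) + Q xp yh
      ≤ (f xh : EReal) + Q xh yh - (((θ₁ - Lf) / 2 * ‖xp - xh‖ ^ 2 : ℝ) : EReal) := by
  have hsc := inner_gradient_add_sq_le_of_convexOn_sub hφ₁sc hφ₁diff xp xh
  have hdesc := le_add_inner_gradient_add_sq (hf.differentiable one_ne_zero) hfLip xp xh
  have h := hmin xh
  have hp := hQproper.1 xp yh
  have hh := hQproper.1 xh yh
  generalize Q xp yh = qp at *
  generalize Q xh yh = qh at *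
  lift qh to ℝ using ⟨hdom.ne, hh⟩
  induction qp with
  | bot => exact absurd rfl hp
  | top =>
    rw [EReal.top_add_coe, ← EReal.coe_add] at h
    exact absurd (top_le_iff.1 h) (EReal.coe_ne_top _)
  | coe qp =>
    norm_cast at h ⊢
    simp only [breg, sub_self, inner_zero_right] at h
    rw [inner_sub_right] at hdesc
    linarith
end

section
/- Suppose f : ℝⁿ → ℝ and g : ℝᵐ → ℝ are continuously differentiable with L_∇f- and L_∇g-Lipschitz gradients respectively, Q : ℝⁿ × ℝᵐ → ℝ ∪ {+∞} is proper and lower semicontinuous, φ₁ : ℝⁿ → ℝ is differentiable and θ₁-strongly convex with θ₁ > L_∇f, and φ₂ : ℝᵐ → ℝ is differentiable and θ₂-strongly convex with θ₂ > L_∇g. Let L(x,y) = f(x) + Q(x,y) + g(y). Fix (x̂, ŷ) with Q(x̂, ŷ) < +∞. If x⁺ minimizes x ↦ Q(x, ŷ) + ⟨∇f(x̂), x⟩ + D_{φ₁}(x, x̂) over ℝⁿ and y⁺ minimizes y ↦ Q(x⁺, y) + ⟨∇g(ŷ), y⟩ + D_{φ₂}(y, ŷ) over ℝᵐ, then L(x⁺,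 y⁺) ≤ L(x̂, ŷ) − ρ(‖x⁺ − x̂‖² + ‖y⁺ − ŷ‖²), where ρ = min{(θ₁ − L_∇f)/2, (θ₂ − L_∇g)/2}. -/
open scoped RealInnerProductSpace

section GradientInequalities

variable {E : Type*} [NormedAddCommGroup E] [InnerProductSpace ℝ E] [CompleteSpace E]

theorem hasDerivAt_comp_add_smul {f : E → ℝ} (hf : Differentiable ℝ f) (a d : E) (t : ℝ) :
    HasDerivAt (fun s : ℝ => f (a + s • d)) ⟪gradient f (a + t • d), d⟫ t := by
  have hline : HasDerivAt (fun s : ℝ => a + s • d) d t := by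
    simpa using ((hasDerivAt_id t).smul_const d).const_add a
  exact ((hf (a + t • d)).hasGradientAt.hasFDerivAt.comp_hasDerivAt t hline).congr_deriv
    (InnerProductSpace.toDual_apply_apply ..)

/-- The descent lemma. -/
theorem le_add_inner_gradient_add_of_lipschitz {f : E → ℝ} (hf : Differentiable ℝ f) {L : ℝ}
    (hL : ∀ a b, ‖gradient f a - gradient f b‖ ≤ L * ‖a - b‖) (x y : E) :
    f x ≤ f y + ⟪gradient f y, x - y⟫ + L / 2 * ‖x - y‖ ^ 2 := by
  set d := x - y with hd
  let h : ℝ → ℝ := fun t => f (y + t • d) - t * ⟪gradient f y, d⟫ - L / 2 * ‖d‖ ^ 2 * t ^ 2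
  have hderiv (t : ℝ) : HasDerivAt h
      (⟪gradient f (y + t • d), d⟫ - ⟪gradient f y, d⟫ - L / 2 * ‖d‖ ^ 2 * (2 * t)) t := by
    refine HasDerivAt.congr_deriv (((hasDerivAt_comp_add_smul hf y d t).sub
      ((hasDerivAt_id t).mul_const ⟪gradient f y, d⟫)).sub
        (((hasDerivAt_id t).pow 2).const_mul (L / 2 * ‖d‖ ^ 2))) ?_
    simp
  have hanti : AntitoneOn h (Set.Icc 0 1) := by
    refine antitoneOn_of_hasDerivWithinAt_nonpos (convex_Icc 0 1)
      (fun t _ => (hderiv t).continuousAt.continuousWithinAt)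
      (fun t _ => (hderiv t).hasDerivWithinAt) fun t ht => ?_
    rw [interior_Icc] at ht
    have hcs := real_inner_le_norm (gradient f (y + t • d) - gradient f y) d
    have hlip := hL (y + t • d) y
    rw [add_sub_cancel_left, norm_smul, Real.norm_of_nonneg ht.1.le] at hlip
    rw [inner_sub_left] at hcs
    nlinarith [mul_le_mul_of_nonneg_right hlip (norm_nonneg d)]
  have h01 := hanti (Set.left_mem_Icc.2 zero_le_one) (Set.right_mem_Icc.2 zero_le_one) zero_le_one
  simp only [h, hd, one_smul, zero_smul, add_zero, add_sub_cancel] at h01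
  rw [hd]
  linarith

/-- The quadratic growth of a strongly convex function over its tangent planes. -/
theorem add_inner_gradient_add_le_of_stronglyConvex {φ : E → ℝ} (hφ : Differentiable ℝ φ) {θ : ℝ}
    (hc : ConvexOn ℝ Set.univ fun u => φ u - θ / 2 * ‖u‖ ^ 2) (x y : E) :
    φ y + ⟪gradient φ y, x - y⟫ + θ / 2 * ‖x - y‖ ^ 2 ≤ φ x := by
  set d := x - y with hd
  let k : ℝ → ℝ := fun t => φ (y + t • d) - θ / 2 * ‖y + t • d‖ ^ 2
  have hk : ConvexOn ℝ Set.univ k := by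
    have hcomp := hc.comp_affineMap (AffineMap.lineMap y x)
    simpa only [Set.preimage_univ, Function.comp_def, AffineMap.lineMap_apply, vsub_eq_sub,
      vadd_eq_add, add_comm _ y] using hcomp
  have hline : HasDerivAt (fun s : ℝ => y + s • d) d 0 := by
    simpa using ((hasDerivAt_id (0 : ℝ)).smul_const d).const_add y
  have hderiv : HasDerivAt k (⟪gradient φ y, d⟫ - θ / 2 * (2 * ⟪y, d⟫)) 0 := by
    refine HasDerivAt.congr_deriv
      ((hasDerivAt_comp_add_smul hφ y d 0).sub (hline.norm_sq.const_mul (θ / 2))) ?_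
    simp only [zero_smul, add_zero]
  have hslope := hk.le_slope_of_hasDerivAt (Set.mem_univ 0) (Set.mem_univ 1) one_pos hderiv
  simp only [slope_def_field, k, one_smul, zero_smul, add_zero, sub_zero, div_one,
    norm_add_sq_real y d] at hslope
  rw [show y + d = x by simp [hd]] at hslope
  linarith

end GradientInequalities

/-- Sufficient decrease for a single Bregman proximal gradient step, where `q` and `q'` are the
values of the nonsmooth part before and after the step. -/
theorem bregman_step_decrease {d : ℕ} {f φ : EuclideanSpace ℝ (Fin d) → ℝ} {L θ : ℝ}
    (hf : Differentiable ℝ f)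
    (hL : ∀ a b, ‖gradient f a - gradient f b‖ ≤ L * ‖a - b‖)
    (hφ : Differentiable ℝ φ)
    (hc : ConvexOn ℝ Set.univ fun u => φ u - θ / 2 * ‖u‖ ^ 2)
    {x x' : EuclideanSpace ℝ (Fin d)} {q : ℝ} {q' : EReal} (hq' : q' ≠ ⊥)
    (h : q' + ((⟪gradient f x, x'⟫ + breg φ x' x : ℝ) : EReal)
      ≤ (q : EReal) + ((⟪gradient f x, x⟫ + breg φ x x : ℝ) : EReal)) :
    ∃ r : ℝ, q' = r ∧ f x' + r ≤ f x + q - (θ - L) / 2 * ‖x' - x‖ ^ 2 := by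
  induction q' with
  | bot => exact absurd rfl hq'
  | top =>
    rw [EReal.top_add_coe, ← EReal.coe_add, top_le_iff] at h
    exact absurd h (EReal.coe_ne_top _)
  | coe r =>
    refine ⟨r, rfl, ?_⟩
    norm_cast at h
    have hdesc := le_add_inner_gradient_add_of_lipschitz hf hL x' x
    have hgrow := add_inner_gradient_add_le_of_stronglyConvex hφ hc x' x
    simp only [breg, sub_self, inner_zero_right] at h
    rw [inner_sub_right (gradient f x)] at hdesc
    linarith

/-- sufficient decrease of `L(x,y) = f(x) + Q(x,y) + g(y)` after one
alternating Bregman proximal gradient step. -/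
theorem one_step_decrease {n m : ℕ}
    (f : EuclideanSpace ℝ (Fin n) → ℝ) (g : EuclideanSpace ℝ (Fin m) → ℝ)
    (Q : EuclideanSpace ℝ (Fin n) → EuclideanSpace ℝ (Fin m) → EReal)
    (φ₁ : EuclideanSpace ℝ (Fin n) → ℝ) (φ₂ : EuclideanSpace ℝ (Fin m) → ℝ)
    (Lf Lg θ₁ θ₂ : ℝ)
    (hf : ContDiff ℝ 1 f) (hg : ContDiff ℝ 1 g)
    (hfLip : ∀ a b, ‖gradient f a - gradient f b‖ ≤ Lf * ‖a - b‖)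
    (hgLip : ∀ a b, ‖gradient g a - gradient g b‖ ≤ Lg * ‖a - b‖)
    (hQproper : (∀ a b, Q a b ≠ ⊥) ∧ ∃ a b, Q a b ≠ ⊤)
    (hQlsc : LowerSemicontinuous
      (fun p : EuclideanSpace ℝ (Fin n) × EuclideanSpace ℝ (Fin m) => Q p.1 p.2))
    (hφ₁diff : Differentiable ℝ φ₁) (hφ₂diff : Differentiable ℝ φ₂)
    (hθ₁pos : 0 < θ₁) (hθ₂pos : 0 < θ₂)
    (hφ₁sc : ConvexOn ℝ Set.univ (fun u => φ₁ u - θ₁ / 2 * ‖u‖ ^ 2))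
    (hφ₂sc : ConvexOn ℝ Set.univ (fun u => φ₂ u - θ₂ / 2 * ‖u‖ ^ 2))
    (hθ₁ : Lf < θ₁) (hθ₂ : Lg < θ₂)
    (xh : EuclideanSpace ℝ (Fin n)) (yh : EuclideanSpace ℝ (Fin m))
    (hdom : Q xh yh < ⊤)
    (xp : EuclideanSpace ℝ (Fin n)) (yp : EuclideanSpace ℝ (Fin m))
    (hxmin : ∀ x', Q xp yh + ((⟪gradient f xh, xp⟫ + breg φ₁ xp xh : ℝ) : EReal)
        ≤ Q x' yh + ((⟪gradient f xh, x'⟫ + breg φ₁ x' xh : ℝ) : EReal))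
    (hymin : ∀ y', Q xp yp + ((⟪gradient g yh, yp⟫ + breg φ₂ yp yh : ℝ) : EReal)
        ≤ Q xp y' + ((⟪gradient g yh, y'⟫ + breg φ₂ y' yh : ℝ) : EReal)) :
    (f xp : EReal) + Q xp yp + (g yp : EReal)
      ≤ (f xh : EReal) + Q xh yh + (g yh : EReal)
        - ((min ((θ₁ - Lf) / 2) ((θ₂ - Lg) / 2)
            * (‖xp - xh‖ ^ 2 + ‖yp - yh‖ ^ 2) : ℝ) : EReal) := by
  lift Q xh yh to ℝ using ⟨hdom.ne, hQproper.1 xh yh⟩ with q hq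
  have hx := hxmin xh
  rw [← hq] at hx
  obtain ⟨r, hr, hrle⟩ := bregman_step_decrease (hf.differentiable one_ne_zero) hfLip hφ₁diff
    hφ₁sc (hQproper.1 xp yh) hx
  have hy := hymin yh
  rw [hr] at hy
  obtain ⟨s, hs, hsle⟩ := bregman_step_decrease (hg.differentiable one_ne_zero) hgLip hφ₂diff
    hφ₂sc (hQproper.1 xp yp) hy
  rw [hs]
  norm_cast
  have hρ₁ := mul_le_mul_of_nonneg_right (min_le_left ((θ₁ - Lf) / 2) ((θ₂ - Lg) / 2))
    (sq_nonneg ‖xp - xh‖)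
  have hρ₂ := mul_le_mul_of_nonneg_right (min_le_right ((θ₁ - Lf) / 2) ((θ₂ - Lg) / 2))
    (sq_nonneg ‖yp - yh‖)
  linarith
end

section
/- Let {a_k} be a sequence of nonnegative real numbers, {Δ_k} a nonincreasing sequence of real numbers bounded below, C > 0, and l ∈ ℕ, such that 2a_{k+1} ≤ C(Δ_k − Δ_{k+1}) + a_k for all k ≥ l. Then Σ_{k=0}^{∞} a_k < ∞. -/
/-- if `a_k ≥ 0`, `Δ_k` is nonincreasing and bounded below,
`C > 0`, and `2a_{k+1} ≤ C(Δ_k − Δ_{k+1}) + a_k` for all `k ≥ l`, then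
`Σ_{k=0}^∞ a_k < ∞`. -/
theorem summable_of_decrease_recursion (a Δ : ℕ → ℝ) (C : ℝ) (l : ℕ)
    (ha : ∀ k, 0 ≤ a k)
    (hΔ : Antitone Δ)
    (hΔbd : ∃ B : ℝ, ∀ k, B ≤ Δ k)
    (hC : 0 < C)
    (hrec : ∀ k, l ≤ k → 2 * a (k + 1) ≤ C * (Δ k - Δ (k + 1)) + a k) :
    Summable a := by
  obtain ⟨B, hB⟩ := hΔbd
  have key : ∀ n, ∑ i ∈ Finset.range n, a (i + l) + 2 * a (n + l)
      ≤ 2 * a l + C * (Δ l - Δ (n + l)) := by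
    intro n
    induction n with
    | zero => simp
    | succ n ih =>
      have h := hrec (n + l) (Nat.le_add_left l n)
      rw [Finset.sum_range_succ, Nat.add_right_comm n 1 l]
      linarith
  rw [← summable_nat_add_iff l]
  refine summable_of_sum_range_le (c := 2 * a l + C * (Δ l - B)) (fun n => ha _) fun n => ?_
  have hbound : C * B ≤ C * Δ (n + l) := mul_le_mul_of_nonneg_left (hB _) hC.le
  linarith [key n, ha (n + l)]
end

section
/- Let {z_k}_{k ≥ 0} be a sequence in ℝ^d (with z_{−1} = z_{−2} = z₀ by convention), and let α_k ∈ [0, ᾱ] and β_k ∈ [0, β̄] be sequences with ᾱ + β̄ < 1. Suppose that for every k ≥ 0, the point ω_k equals either z_k + α_k(z_k − z_{k−1}) + β_k(z_{k−1} − z_{k−2}) or z_k. If Σ_{k=0}^{∞} ‖z_{k+1} − ω_k‖ < ∞, then Σ_{k=0}^{∞} ‖z_{k+1} − z_k‖ < ∞. -/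
/-- A nonnegative real sequence satisfying a two-step linear recursive inequality with
coefficients of sum less than one and a summable perturbation is summable. -/
theorem summable_of_le_two_step {u e : ℕ → ℝ} {a b : ℝ} (hu : ∀ k, 0 ≤ u k)
    (hb : 0 ≤ b) (hab : a + b < 1) (he0 : ∀ k, 0 ≤ e k) (he : Summable e)
    (h : ∀ k, u (k + 2) ≤ e k + a * u (k + 1) + b * u k) : Summable u := by
  have key : ∀ n, (1 - a - b) * ∑ k ∈ Finset.range n, u (k + 1) + (u (n + 1) + b * u n)
      ≤ u 1 + b * u 0 + ∑ k ∈ Finset.range n, e k := by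
    intro n
    induction n with
    | zero => simp
    | succ n ih =>
      rw [Finset.sum_range_succ, Finset.sum_range_succ]
      linarith [h n]
  refine (summable_nat_add_iff 1).1 (summable_of_sum_range_le
    (c := (u 1 + b * u 0 + ∑' k, e k) / (1 - a - b)) (fun k => hu _) fun n => ?_)
  rw [le_div_iff₀' (by linarith)]
  linarith [key n, hu (n + 1), mul_nonneg hb (hu n),
    he.sum_le_tsum (Finset.range n) fun k _ => he0 k]

/-- if `ω_k` is either the two-step extrapolation
`z_k + α_k(z_k − z_{k−1}) + β_k(z_{k−1} − z_{k−2})` or `z_k` itself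
(with the convention `z_{−1} = z_{−2} = z₀`, realized by truncated
subtraction on `ℕ`), the extrapolation parameters satisfy
`α_k ∈ [0, ᾱ]`, `β_k ∈ [0, β̄]`, `ᾱ + β̄ < 1`, and
`Σ ‖z_{k+1} − ω_k‖ < ∞`, then `Σ ‖z_{k+1} − z_k‖ < ∞`. -/
theorem summable_increments_of_summable_residuals {d : ℕ}
    (z ω : ℕ → EuclideanSpace ℝ (Fin d)) (α β : ℕ → ℝ) (ab bb : ℝ)
    (hα : ∀ k, α k ∈ Set.Icc (0 : ℝ) ab)
    (hβ : ∀ k, β k ∈ Set.Icc (0 : ℝ) bb)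
    (hab : ab + bb < 1)
    (hω : ∀ k, ω k = z k + α k • (z k - z (k - 1)) + β k • (z (k - 1) - z (k - 2))
        ∨ ω k = z k)
    (hsum : Summable (fun k => ‖z (k + 1) - ω k‖)) :
    Summable (fun k => ‖z (k + 1) - z k‖) := by
  have ha : 0 ≤ ab := (hα 0).1.trans (hα 0).2
  have hb : 0 ≤ bb := (hβ 0).1.trans (hβ 0).2
  refine summable_of_le_two_step (e := fun k => ‖z (k + 2 + 1) - ω (k + 2)‖) (a := ab) (b := bb)
    (fun k => norm_nonneg _) hb hab (fun k => norm_nonneg _)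
    ((summable_nat_add_iff 2).2 hsum) fun k => ?_
  have hstep : ‖ω (k + 2) - z (k + 2)‖
      ≤ ab * ‖z (k + 1 + 1) - z (k + 1)‖ + bb * ‖z (k + 1) - z k‖ := by
    rcases hω (k + 2) with h | h
    · rw [h, add_assoc, add_sub_cancel_left]
      refine (norm_add_le _ _).trans ?_
      rw [norm_smul, norm_smul, Real.norm_of_nonneg (hα _).1, Real.norm_of_nonneg (hβ _).1]
      exact add_le_add (mul_le_mul_of_nonneg_right (hα _).2 (norm_nonneg _))
        (mul_le_mul_of_nonneg_right (hβ _).2 (norm_nonneg _))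
    · rw [h, sub_self, norm_zero]
      positivity
  linarith [norm_sub_le_norm_sub_add_norm_sub (z (k + 2 + 1)) (ω (k + 2)) (z (k + 2))]
end

section
/- Let f : ℝⁿ → ℝ be continuously differentiable with L-Lipschitz gradient, Q : ℝⁿ × ℝᵐ → ℝ ∪ {+∞} proper and lower semicontinuous, and φ₁ : ℝⁿ → ℝ differentiable and θ₁-strongly convex with θ₁ > 0. Let t > 0 and δ > 0 satisfy t·θ₁ ≥ L + δ, and fix x̂ ∈ ℝⁿ, ŷ ∈ ℝᵐ with Q(x̂, ŷ) < +∞. If x⁺ minimizes x ↦ Q(x, ŷ) + ⟨∇f(x̂), x⟩ + t·D_{φ₁}(x, x̂) over ℝⁿ, then the sufficient-decrease condition Q(x⁺, ŷ) + f(x⁺) ≤ Q(x̂, ŷ) + f(x̂) − (δ/2)‖x⁺ − x̂‖² holds. -/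
open scoped RealInnerProductSpace

section

variable {E : Type*} [NormedAddCommGroup E] [InnerProductSpace ℝ E] [CompleteSpace E]

/-- The derivative of a function along the line `s ↦ x + s • v`. -/
lemma DifferentiableAt.hasDerivAt_line {f : E → ℝ} {x v : E} {s : ℝ}
    (hf : DifferentiableAt ℝ f (x + s • v)) :
    HasDerivAt (fun r : ℝ => f (x + r • v)) ⟪gradient f (x + s • v), v⟫ s := by
  have hline : HasDerivAt (fun r : ℝ => x + r • v) v s := by
    simpa using ((hasDerivAt_id s).smul_const v).const_add x
  simpa [Function.comp_def] using
    hf.hasGradientAt.hasFDerivAt.comp_hasDerivAt s hline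

/-- The descent lemma: a function with `L`-Lipschitz gradient lies below its quadratic model. -/
lemma descent_of_lipschitz_gradient {f : E → ℝ} {L : ℝ} (hf : Differentiable ℝ f)
    (hL : ∀ a b, ‖gradient f a - gradient f b‖ ≤ L * ‖a - b‖) (x v : E) :
    f (x + v) ≤ f x + ⟪gradient f x, v⟫ + L / 2 * ‖v‖ ^ 2 := by
  have hd (s : ℝ) : HasDerivAt
      (fun r : ℝ => f (x + r • v) - r * ⟪gradient f x, v⟫ - L / 2 * ‖v‖ ^ 2 * r ^ 2)
      (⟪gradient f (x + s • v) - gradient f x, v⟫ - L * s * ‖v‖ ^ 2) s := by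
    refine (((hf (x + s • v)).hasDerivAt_line.sub
      ((hasDerivAt_id s).mul_const ⟪gradient f x, v⟫)).sub
      ((hasDerivAt_pow 2 s).const_mul (L / 2 * ‖v‖ ^ 2))).congr_deriv ?_
    rw [inner_sub_left]
    push_cast
    ring
  have hanti := antitoneOn_of_deriv_nonpos (convex_Icc (0 : ℝ) 1)
    (fun s _ => (hd s).continuousAt.continuousWithinAt)
    (fun s _ => (hd s).differentiableAt.differentiableWithinAt) (fun s hs => by
      rw [(hd s).deriv]
      rw [interior_Icc] at hs
      have h1 := real_inner_le_norm (gradient f (x + s • v) - gradient f x) v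
      have h2 := mul_le_mul_of_nonneg_right (hL (x + s • v) x) (norm_nonneg v)
      rw [add_sub_cancel_left, norm_smul, Real.norm_of_nonneg hs.1.le] at h2
      linarith)
  have h := hanti (Set.left_mem_Icc.2 zero_le_one) (Set.right_mem_Icc.2 zero_le_one) zero_le_one
  simp only [one_smul, zero_smul, add_zero] at h
  linarith

/-- A differentiable strongly convex function lies above its quadratic lower model. -/
lemma quadratic_lower_bound_of_strongly_convex {φ : E → ℝ} {θ : ℝ} (hφ : Differentiable ℝ φ)
    (hc : ConvexOn ℝ Set.univ (fun u => φ u - θ / 2 * ‖u‖ ^ 2)) (x v : E) :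
    φ x + ⟪gradient φ x, v⟫ + θ / 2 * ‖v‖ ^ 2 ≤ φ (x + v) := by
  have hexp (r : ℝ) : ‖x + r • v‖ ^ 2 = ‖x‖ ^ 2 + r * (2 * ⟪x, v⟫) + ‖v‖ ^ 2 * r ^ 2 := by
    rw [norm_add_sq_real, inner_smul_right, norm_smul, mul_pow, Real.norm_eq_abs, sq_abs]
    ring
  have hconv : ConvexOn ℝ Set.univ (fun r : ℝ => φ (x + r • v) - θ / 2 * ‖x + r • v‖ ^ 2) := by
    simpa [Function.comp_def, AffineMap.lineMap_apply, add_comm] using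
      hc.comp_affineMap (AffineMap.lineMap x (x + v) : ℝ →ᵃ[ℝ] E)
  have hd : HasDerivAt (fun r : ℝ => φ (x + r • v) - θ / 2 * ‖x + r • v‖ ^ 2)
      (⟪gradient φ x, v⟫ - θ * ⟪x, v⟫) 0 := by
    simp_rw [hexp]
    refine ((hφ (x + (0 : ℝ) • v)).hasDerivAt_line.sub
      (((((hasDerivAt_id (0 : ℝ)).mul_const (2 * ⟪x, v⟫)).const_add (‖x‖ ^ 2)).add
        ((hasDerivAt_pow 2 (0 : ℝ)).const_mul (‖v‖ ^ 2))).const_mul (θ / 2))).congr_deriv ?_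
    simp only [zero_smul, add_zero]
    norm_num
    ring
  have h := hconv.le_slope_of_hasDerivAt (Set.mem_univ 0) (Set.mem_univ 1) zero_lt_one hd
  rw [slope_def_field, hexp 1, hexp 0] at h
  simp only [one_smul, zero_smul, add_zero, sub_zero, div_one] at h
  linarith

end

/-- the sufficient-decrease property of the backtracking step.
If `t·θ₁ ≥ L + δ` and `x⁺` minimizes
`x ↦ Q(x, ŷ) + ⟨∇f(x̂), x⟩ + t·D_{φ₁}(x, x̂)`, then
`Q(x⁺, ŷ) + f(x⁺) ≤ Q(x̂, ŷ) + f(x̂) − (δ/2)‖x⁺ − x̂‖²`. -/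
theorem backtracking_sufficient_decrease {n m : ℕ}
    (f : EuclideanSpace ℝ (Fin n) → ℝ)
    (Q : EuclideanSpace ℝ (Fin n) → EuclideanSpace ℝ (Fin m) → EReal)
    (φ₁ : EuclideanSpace ℝ (Fin n) → ℝ) (L θ₁ t δ : ℝ)
    (hf : ContDiff ℝ 1 f)
    (hfLip : ∀ a b, ‖gradient f a - gradient f b‖ ≤ L * ‖a - b‖)
    (hQproper : (∀ a b, Q a b ≠ ⊥) ∧ ∃ a b, Q a b ≠ ⊤)
    (hQlsc : LowerSemicontinuous
      (fun p : EuclideanSpace ℝ (Fin n) × EuclideanSpace ℝ (Fin m) => Q p.1 p.2))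
    (hφ₁diff : Differentiable ℝ φ₁) (hθ₁pos : 0 < θ₁)
    (hφ₁sc : ConvexOn ℝ Set.univ (fun u => φ₁ u - θ₁ / 2 * ‖u‖ ^ 2))
    (ht : 0 < t) (hδ : 0 < δ) (htθ : L + δ ≤ t * θ₁)
    (xh : EuclideanSpace ℝ (Fin n)) (yh : EuclideanSpace ℝ (Fin m))
    (hdom : Q xh yh < ⊤)
    (xp : EuclideanSpace ℝ (Fin n))
    (hmin : ∀ x', Q xp yh + ((⟪gradient f xh, xp⟫ + t * breg φ₁ xp xh : ℝ) : EReal)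
        ≤ Q x' yh + ((⟪gradient f xh, x'⟫ + t * breg φ₁ x' xh : ℝ) : EReal)) :
    Q xp yh + (f xp : EReal)
      ≤ Q xh yh + (f xh : EReal) - ((δ / 2 * ‖xp - xh‖ ^ 2 : ℝ) : EReal) := by
  have hdesc := descent_of_lipschitz_gradient (hf.differentiable one_ne_zero) hfLip xh (xp - xh)
  have hlow := quadratic_lower_bound_of_strongly_convex hφ₁diff hφ₁sc xh (xp - xh)
  rw [add_sub_cancel] at hdesc hlow
  have hbreg : θ₁ / 2 * ‖xp - xh‖ ^ 2 ≤ breg φ₁ xp xh := by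
    unfold breg
    linarith
  have hself : breg φ₁ xh xh = 0 := by simp [breg]
  have hm := hmin xh
  rw [hself] at hm
  have hbot := hQproper.1 xp yh
  lift Q xh yh to ℝ using ⟨hdom.ne, hQproper.1 xh yh⟩ with b
  induction hq : Q xp yh with
  | bot => exact absurd hq hbot
  | top =>
    rw [hq, EReal.top_add_coe, ← EReal.coe_add] at hm
    exact absurd hm (EReal.coe_lt_top _).not_ge
  | coe a =>
    rw [hq] at hm
    norm_cast at hm ⊢
    have h1 := mul_le_mul_of_nonneg_left hbreg ht.le
    have h2 := mul_le_mul_of_nonneg_right htθ (sq_nonneg ‖xp - xh‖)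
    rw [inner_sub_right] at hdesc
    linarith
end
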